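/- arXiv:2408.13755 — 2 statements merged into one kernel-verified Lean document; each statement's English description precedes it below -/
import Mathlib

section
/- Let A and B be nonempty finite sets of integers with |A| = 4 and |B| ≥ 2. Then |A +̂ B| = |A| + |B| - 3 if and only if A = B and there exist integers a, c, d such that A = {a, c, a + d, c + d} (with these four elements distinct, i.e., |{a, c, a + d, c + d}| = 4). -/
/-- The restricted sumset of two finite sets of integers:
`A +̂ B = {a + b : a ∈ A, b ∈ B, a ≠ b}`. -/
def restrictedSumset (A B : Finset ℤ) : Finset ℤ :=
  ((A ×ˢ B).filter fun p => p.1 ≠ p.2).image fun p => p.1 + p.2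

theorem rs_mem {A B : Finset ℤ} {t : ℤ} :
    t ∈ restrictedSumset A B ↔ ∃ a ∈ A, ∃ b ∈ B, a ≠ b ∧ a + b = t := by
  simp only [restrictedSumset, Finset.mem_image, Finset.mem_filter, Finset.mem_product, Prod.exists]
  constructor
  · rintro ⟨a, b, ⟨⟨h1, h2⟩, h3⟩, h4⟩
    exact ⟨a, h1, b, h2, h3, h4⟩
  · rintro ⟨a, h1, b, h2, h3, h4⟩
    exact ⟨a, b, ⟨⟨h1, h2⟩, h3⟩, h4⟩

theorem rs_comm (A B : Finset ℤ) : restrictedSumset A B = restrictedSumset B A := by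
  ext t
  simp only [rs_mem]
  constructor
  · rintro ⟨a, h1, b, h2, h3, h4⟩
    exact ⟨b, h2, a, h1, h3.symm, by omega⟩
  · rintro ⟨a, h1, b, h2, h3, h4⟩
    exact ⟨b, h2, a, h1, h3.symm, by omega⟩

theorem rs_mono {A B A' B' : Finset ℤ} (h : A' ⊆ A) (h' : B' ⊆ B) :
    restrictedSumset A' B' ⊆ restrictedSumset A B := by
  intro t
  simp only [rs_mem]
  rintro ⟨a, h1, b, h2, h3, h4⟩
  exact ⟨a, h h1, b, h' h2, h3, h4⟩

theorem exists_top (S : Finset ℤ) (hS : S.Nonempty) : ∃ x ∈ S, ∀ u ∈ S, u ≤ x :=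
  ⟨S.max' hS, S.max'_mem hS, fun u hu => S.le_max' u hu⟩

theorem top_two (S : Finset ℤ) (hS : 2 ≤ S.card) :
    ∃ x ∈ S, ∃ y ∈ S, y < x ∧ ∀ u ∈ S, ∀ v ∈ S, u ≠ v → u + v ≤ x + y := by
  obtain ⟨x, hx, hx'⟩ := exists_top S (Finset.card_pos.1 (by omega))
  obtain ⟨y, hy, hy'⟩ := exists_top (S.erase x)
    (Finset.card_pos.1 (by rw [Finset.card_erase_of_mem hx]; omega))
  rw [Finset.mem_erase] at hy
  refine ⟨x, hx, y, hy.2, lt_of_le_of_ne (hx' y hy.2) hy.1, ?_⟩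
  intro u hu v hv huv
  have h1 := hx' u hu
  have h2 := hx' v hv
  by_cases h : u = x
  · have := hy' v (Finset.mem_erase.2 ⟨by omega, hv⟩)
    omega
  · have := hy' u (Finset.mem_erase.2 ⟨h, hu⟩)
    omega

theorem add_one_elt {T R : Finset ℤ} {p : ℤ} (h : T ⊆ R) (hp : p ∈ R) (hT : ∀ t ∈ T, t < p) :
    T.card + 1 ≤ R.card := by
  have h1 : p ∉ T := fun h => lt_irrefl _ (hT p h)
  rw [← Finset.card_insert_of_notMem h1]
  exact Finset.card_le_card (Finset.insert_subset hp h)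

theorem add_two_elt {T R : Finset ℤ} {p q : ℤ} (h : T ⊆ R) (hp : p ∈ R) (hq : q ∈ R)
    (hpq : p < q) (hT : ∀ t ∈ T, t < p) : T.card + 2 ≤ R.card := by
  have h1 : p ∉ T := fun h => lt_irrefl _ (hT p h)
  have := add_one_elt (T := insert p T) (R := R) (p := q) (Finset.insert_subset hp h) hq (by
    intro t ht
    rcases Finset.mem_insert.1 ht with rfl | ht
    · exact hpq
    · exact (hT t ht).trans hpq)
  rw [Finset.card_insert_of_notMem h1] at this
  omega

theorem rs_single (A B : Finset ℤ) (hA : A.card = 1) :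
    A.card + B.card ≤ (restrictedSumset A B).card + 2 := by
  obtain ⟨a, rfl⟩ := Finset.card_eq_one.1 hA
  have h : (B.erase a).image (fun b => a + b) ⊆ restrictedSumset {a} B := by
    intro t ht
    obtain ⟨b, hb, rfl⟩ := Finset.mem_image.1 ht
    rw [Finset.mem_erase] at hb
    exact rs_mem.2 ⟨a, Finset.mem_singleton_self a, b, hb.2, hb.1.symm, rfl⟩
  have h1 := Finset.card_le_card h
  rw [Finset.card_image_of_injective _ (add_right_injective a)] at h1
  have h2 := Finset.pred_card_le_card_erase (s := B) (a := a)
  omega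

def RSBound (A B : Finset ℤ) : Prop :=
  A.card + B.card ≤ (restrictedSumset A B).card + 2

theorem step_gt (A B : Finset ℤ) (hA : A.Nonempty) (m : ℤ) (hm : m ∈ B)
    (hB2 : 2 ≤ B.card) (hmB : ∀ b ∈ B, b ≤ m) (hmA : ∀ a ∈ A, a < m)
    (ih : ∀ A' B' : Finset ℤ, A'.card + B'.card < A.card + B.card → A'.Nonempty → B'.Nonempty →
      A' ≠ B' → RSBound A' B') : RSBound A B := by
  have hc := Finset.card_erase_of_mem hm
  by_cases h : A = B.erase m
  · by_cases h1 : A.card = 1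
    · exact rs_single A B h1
    rw [← h] at hc
    have hpos := Finset.card_pos.2 hA
    obtain ⟨x, hx, y, hy, hyx, ht⟩ := top_two A (by omega)
    have hcx := Finset.card_erase_of_mem hx
    have i1 := ih A (A.erase x) (by omega) hA (Finset.card_pos.1 (by omega)) (by
      intro h; rw [← h] at hcx; omega)
    have hx' := hmA x hx
    have hy' := hmA y hy
    have hAB : A ⊆ B := by rw [h]; exact Finset.erase_subset _ _
    have i2 := add_two_elt (T := restrictedSumset A (A.erase x)) (R := restrictedSumset A B)
      (p := y + m) (q := x + m) (rs_mono (fun _ h => h) ((Finset.erase_subset _ _).trans hAB))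
      (rs_mem.2 ⟨y, hy, m, hm, by omega, rfl⟩) (rs_mem.2 ⟨x, hx, m, hm, by omega, rfl⟩)
      (by omega) (by
        intro t h
        obtain ⟨a, ha, b, hb, hab, rfl⟩ := rs_mem.1 h
        have := ht a ha b (Finset.mem_of_mem_erase hb) hab
        omega)
    unfold RSBound at *
    omega
  · have i1 := ih A (B.erase m) (by omega) hA (Finset.card_pos.1 (by omega)) h
    obtain ⟨x, hx, hx'⟩ := exists_top A hA
    have := hmA x hx
    have i2 := add_one_elt (T := restrictedSumset A (B.erase m)) (R := restrictedSumset A B)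
      (p := x + m) (rs_mono (fun _ h => h) (Finset.erase_subset _ _))
      (rs_mem.2 ⟨x, hx, m, hm, by omega, rfl⟩) (by
        intro t h
        obtain ⟨a, ha, b, hb, hab, rfl⟩ := rs_mem.1 h
        rw [Finset.mem_erase] at hb
        have := hx' a ha
        have := hmB b hb.2
        have := hb.1
        omega)
    unfold RSBound at *
    omega

theorem step_eq (A B : Finset ℤ) (hAB : A ≠ B) (m : ℤ) (hm : m ∈ B) (hm' : m ∈ A)
    (hA2 : 2 ≤ A.card) (hB2 : 2 ≤ B.card) (hmB : ∀ b ∈ B, b ≤ m) (hmA : ∀ a ∈ A, a ≤ m)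
    (ih : ∀ A' B' : Finset ℤ, A'.card + B'.card < A.card + B.card → A'.Nonempty → B'.Nonempty →
      A' ≠ B' → RSBound A' B') : RSBound A B := by
  have hcB := Finset.card_erase_of_mem hm
  have hcA := Finset.card_erase_of_mem hm'
  have hne : A.erase m ≠ B.erase m := by
    intro h
    apply hAB
    rw [← Finset.insert_erase hm, ← Finset.insert_erase hm', h]
  have i1 := ih (A.erase m) (B.erase m) (by omega) (Finset.card_pos.1 (by omega))
    (Finset.card_pos.1 (by omega)) hne
  have hU : 2 ≤ (A.erase m ∪ B.erase m).card := by
    by_contra hcon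
    apply hne
    have e1 := Finset.eq_of_subset_of_card_le
      (Finset.subset_union_left (s₁ := A.erase m) (s₂ := B.erase m)) (by omega)
    have e2 := Finset.eq_of_subset_of_card_le
      (Finset.subset_union_right (s₁ := A.erase m) (s₂ := B.erase m)) (by omega)
    rw [e1]; exact e2.symm
  obtain ⟨x, hx, y, hy, hyx, ht⟩ := top_two _ hU
  have key : ∀ z ∈ A.erase m ∪ B.erase m, z < m ∧ m + z ∈ restrictedSumset A B := by
    intro z hz
    rcases Finset.mem_union.1 hz with h | h
    · rw [Finset.mem_erase] at h
      have := hmA z h.2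
      have := h.1
      exact ⟨by omega, rs_mem.2 ⟨z, h.2, m, hm, h.1, by omega⟩⟩
    · rw [Finset.mem_erase] at h
      have := hmB z h.2
      have := h.1
      exact ⟨by omega, rs_mem.2 ⟨m, hm', z, h.2, h.1.symm, rfl⟩⟩
  have kx := key x hx
  have ky := key y hy
  have i2 := add_two_elt (T := restrictedSumset (A.erase m) (B.erase m))
    (rs_mono (Finset.erase_subset _ _) (Finset.erase_subset _ _)) ky.2 kx.2 (by omega) (by
      intro t h
      obtain ⟨a, ha, b, hb, hab, rfl⟩ := rs_mem.1 h
      have := ht a (Finset.mem_union_left _ ha) b (Finset.mem_union_right _ hb) hab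
      omega)
  unfold RSBound at *
  omega

theorem RSBound.symm {A B : Finset ℤ} (h : RSBound A B) : RSBound B A := by
  unfold RSBound at *
  rw [rs_comm, add_comm]
  exact h

theorem rs_bound (n : ℕ) : ∀ A B : Finset ℤ, A.card + B.card = n → A.Nonempty → B.Nonempty →
    A ≠ B → RSBound A B := by
  induction n using Nat.strong_induction_on with
  | _ n IH =>
    intro A B hn hA hB hAB
    have ih : ∀ A' B' : Finset ℤ, A'.card + B'.card < A.card + B.card → A'.Nonempty →
        B'.Nonempty → A' ≠ B' → RSBound A' B' := fun A' B' h => IH _ (hn ▸ h) A' B' rfl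
    by_cases hA1 : A.card = 1
    · exact rs_single A B hA1
    by_cases hB1 : B.card = 1
    · exact RSBound.symm (rs_single B A hB1)
    have hpA := Finset.card_pos.2 hA
    have hpB := Finset.card_pos.2 hB
    obtain ⟨x, hx, hx'⟩ := exists_top A hA
    obtain ⟨y, hy, hy'⟩ := exists_top B hB
    rcases lt_trichotomy x y with h | h | h
    · exact step_gt A B hA y hy (by omega) hy' (fun a ha => (hx' a ha).trans_lt h) ih
    · subst h
      exact step_eq A B hAB x hy hx (by omega) (by omega) hy' hx' ih
    · refine RSBound.symm (step_gt B A hB x hx (by omega) hx' (fun a ha => (hy' a ha).trans_lt h) ?_)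
      intro A' B' h
      exact ih A' B' (by omega)

theorem four_sorted (A : Finset ℤ) (hA : A.card = 4) :
    ∃ p q r s : ℤ, p < q ∧ q < r ∧ r < s ∧ A = {p, q, r, s} := by
  let f := A.orderEmbOfFin hA
  refine ⟨f 0, f 1, f 2, f 3, f.strictMono (by decide), f.strictMono (by decide),
    f.strictMono (by decide), ?_⟩
  have h : Finset.univ.image f = A := by
    apply Finset.coe_injective
    simp [f]
  rw [← h]
  ext t
  simp [Fin.exists_fin_succ, eq_comm]

theorem rs_four {p q r s : ℤ} (h1 : p < q) (h2 : q < r) (h3 : r < s) :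
    restrictedSumset {p, q, r, s} {p, q, r, s} = {p + q, p + r, p + s, q + r, q + s, r + s} := by
  ext t
  simp only [rs_mem, Finset.mem_insert, Finset.mem_singleton]
  constructor
  · rintro ⟨a, ha, b, hb, hab, rfl⟩
    omega
  · rintro (h | h | h | h | h | h)
    · exact ⟨p, by simp, q, by simp, by omega, h.symm⟩
    · exact ⟨p, by simp, r, by simp, by omega, h.symm⟩
    · exact ⟨p, by simp, s, by simp, by omega, h.symm⟩
    · exact ⟨q, by simp, r, by simp, by omega, h.symm⟩
    · exact ⟨q, by simp, s, by simp, by omega, h.symm⟩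
    · exact ⟨r, by simp, s, by simp, by omega, h.symm⟩

theorem card_rs_four {p q r s : ℤ} (h1 : p < q) (h2 : q < r) (h3 : r < s) :
    (restrictedSumset {p, q, r, s} {p, q, r, s}).card = 5 ↔ p + s = q + r := by
  rw [rs_four h1 h2 h3]
  constructor
  · intro h
    by_contra hne
    rw [Finset.card_insert_of_notMem, Finset.card_insert_of_notMem, Finset.card_insert_of_notMem,
      Finset.card_insert_of_notMem, Finset.card_insert_of_notMem, Finset.card_singleton] at h
    · omega
    all_goals simp only [Finset.mem_insert, Finset.mem_singleton]; omega
  · intro h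
    rw [h, Finset.card_insert_of_notMem, Finset.card_insert_of_notMem, Finset.insert_idem,
      Finset.card_insert_of_notMem, Finset.card_insert_of_notMem, Finset.card_singleton]
    all_goals simp only [Finset.mem_insert, Finset.mem_singleton]; omega

theorem stmt_2 (A B : Finset ℤ) (hA : A.card = 4) (hB : 2 ≤ B.card) :
    (restrictedSumset A B).card = A.card + B.card - 3 ↔
      A = B ∧ ∃ a c d : ℤ, A = {a, c, a + d, c + d} ∧
        ({a, c, a + d, c + d} : Finset ℤ).card = 4 := by
  constructor
  · intro h
    have hAB : A = B := by
      by_contra hne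
      have := rs_bound _ A B rfl (Finset.card_pos.1 (by omega)) (Finset.card_pos.1 (by omega)) hne
      unfold RSBound at this
      omega
    refine ⟨hAB, ?_⟩
    subst hAB
    rw [hA] at h
    obtain ⟨p, q, r, s, h1, h2, h3, rfl⟩ := four_sorted A hA
    have h4 := (card_rs_four h1 h2 h3).1 h
    have e : ({p, q, p + (r - p), q + (r - p)} : Finset ℤ) = {p, q, r, s} := by
      rw [show p + (r - p) = r by ring, show q + (r - p) = s by omega]
    exact ⟨p, q, r - p, e.symm, by rw [e]; exact hA⟩
  · rintro ⟨rfl, a, c, d, h, -⟩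
    rw [hA]
    obtain ⟨p, q, r, s, h1, h2, h3, rfl⟩ := four_sorted A hA
    refine (card_rs_four h1 h2 h3).2 ?_
    have hs : ∑ x ∈ ({p, q, r, s} : Finset ℤ), x = p + q + r + s := by
      rw [Finset.sum_insert, Finset.sum_insert, Finset.sum_insert, Finset.sum_singleton]
      · ring
      all_goals simp only [Finset.mem_insert, Finset.mem_singleton]; omega
    have m1 : p ∈ ({a, c, a + d, c + d} : Finset ℤ) := by rw [← h]; simp
    have m2 : q ∈ ({a, c, a + d, c + d} : Finset ℤ) := by rw [← h]; simp
    have m3 : r ∈ ({a, c, a + d, c + d} : Finset ℤ) := by rw [← h]; simp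
    have m4 : s ∈ ({a, c, a + d, c + d} : Finset ℤ) := by rw [← h]; simp
    clear hs h
    simp only [Finset.mem_insert, Finset.mem_singleton] at m1 m2 m3 m4
    omega
end

section
/- Let A and B be finite sets of integers with |A| ≥ 2, |B| ≥ 2, and B a proper subset of A (B ⊊ A). Then |A +̂ B| ≥ |A| + |B| - 2. -/
theorem mem_rs (A B : Finset ℤ) (x : ℤ) :
    x ∈ restrictedSumset A B ↔ ∃ a ∈ A, ∃ b ∈ B, a ≠ b ∧ a + b = x := by
  simp only [restrictedSumset, Finset.mem_image, Finset.mem_filter, Finset.mem_product, Prod.exists]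
  constructor
  · rintro ⟨a, b, ⟨⟨ha, hb⟩, hn⟩, h⟩
    exact ⟨a, ha, b, hb, hn, h⟩
  · rintro ⟨a, ha, b, hb, hn, h⟩
    exact ⟨a, b, ⟨⟨ha, hb⟩, hn⟩, h⟩

theorem rs_aux (k : ℕ) : ∀ A B : Finset ℤ, B.card = k + 1 → B ⊂ A →
    A.card + B.card ≤ (restrictedSumset A B).card + 2 := by
  induction k with
  | zero =>
    intro A B hB hBA
    obtain ⟨b, rfl⟩ := Finset.card_eq_one.1 hB
    have hb : b ∈ A := hBA.1 (by simp)
    have h1 : (A.erase b).image (fun x => x + b) ⊆ restrictedSumset A {b} := by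
      intro x hx
      obtain ⟨a, ha, rfl⟩ := Finset.mem_image.1 hx
      rw [mem_rs]
      exact ⟨a, Finset.mem_of_mem_erase ha, b, by simp, Finset.ne_of_mem_erase ha, rfl⟩
    have h2 := Finset.card_le_card h1
    rw [Finset.card_image_of_injective _ (add_left_injective b), Finset.card_erase_of_mem hb] at h2
    simp only [Finset.card_singleton]
    omega
  | succ k ih =>
    intro A B hB hBA
    have hBne : B.Nonempty := Finset.card_pos.1 (by omega)
    have hAne : A.Nonempty := hBne.mono hBA.1
    obtain ⟨M, hMA, hM⟩ : ∃ M ∈ A, ∀ a ∈ A, a ≤ M :=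
      ⟨A.max' hAne, A.max'_mem _, fun a ha => A.le_max' a ha⟩
    by_cases hMB : M ∈ B
    · obtain ⟨c, hcA, hcB⟩ := Finset.exists_of_ssubset hBA
      have hlt := Finset.card_lt_card hBA
      have hcM : c ≠ M := fun h => hcB (h ▸ hMB)
      have hss : B.erase M ⊂ A.erase M := by
        refine (Finset.ssubset_iff_of_subset (Finset.erase_subset_erase _ hBA.1)).2 ⟨c, ?_, ?_⟩
        · exact Finset.mem_erase.2 ⟨hcM, hcA⟩
        · exact fun h => hcB (Finset.mem_of_mem_erase h)
      have hcardB : (B.erase M).card = k + 1 := by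
        rw [Finset.card_erase_of_mem hMB]; omega
      have hcardA : (A.erase M).card = A.card - 1 := Finset.card_erase_of_mem hMA
      have IH := ih _ _ hcardB hss
      have hne1 : (A.erase M).Nonempty := Finset.card_pos.1 (by omega)
      obtain ⟨y, hyA, hy⟩ : ∃ y ∈ A.erase M, ∀ a ∈ A.erase M, a ≤ y :=
        ⟨_, Finset.max'_mem _ hne1, fun a ha => Finset.le_max' _ a ha⟩
      have hne2 : ((A.erase M).erase y).Nonempty := Finset.card_pos.1 (by
        rw [Finset.card_erase_of_mem hyA]; omega)
      obtain ⟨x, hxA, hx⟩ : ∃ x ∈ (A.erase M).erase y, ∀ a ∈ (A.erase M).erase y, a ≤ x :=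
        ⟨_, Finset.max'_mem _ hne2, fun a ha => Finset.le_max' _ a ha⟩
      simp only [Finset.mem_erase] at hyA hy hxA hx
      have hyM := hM y hyA.2
      have hxy := hy x hxA.2
      have hbig : ∀ s ∈ restrictedSumset (A.erase M) (B.erase M), s < x + M := by
        intro s hs
        obtain ⟨a, ha, b, hb, hn, rfl⟩ := (mem_rs _ _ _).1 hs
        have hb' := Finset.mem_erase.1 (hss.1 hb)
        have ha' := Finset.mem_erase.1 ha
        have h1 := hy a ha'
        have h2 := hy b hb'
        have h3 := hx a
        have h4 := hx b
        by_cases hay : a = y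
        · have := h4 ⟨fun h => hn (hay.trans h.symm), hb'⟩
          have := hyA.1
          omega
        · have := h3 ⟨hay, ha'⟩
          have := hyA.1
          omega
      have hsub : insert (y + M) (insert (x + M) (restrictedSumset (A.erase M) (B.erase M)))
          ⊆ restrictedSumset A B := by
        intro s hs
        rw [mem_rs]
        rcases Finset.mem_insert.1 hs with rfl | hs
        · exact ⟨y, hyA.2, M, hMB, hyA.1, rfl⟩
        rcases Finset.mem_insert.1 hs with rfl | hs
        · exact ⟨x, hxA.2.2, M, hMB, hxA.2.1, rfl⟩
        obtain ⟨a, ha, b, hb, hn, rfl⟩ := (mem_rs _ _ _).1 hs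
        exact ⟨a, Finset.mem_of_mem_erase ha, b, Finset.mem_of_mem_erase hb, hn, rfl⟩
      have hc := Finset.card_le_card hsub
      have hn1 : x + M ∉ restrictedSumset (A.erase M) (B.erase M) := fun h => by
        have := hbig _ h
        omega
      have hn2 : y + M ∉ insert (x + M) (restrictedSumset (A.erase M) (B.erase M)) := by
        intro h
        rcases Finset.mem_insert.1 h with h | h
        · exact hxA.1 (by omega)
        · have := hbig _ h
          omega
      rw [Finset.card_insert_of_notMem hn2, Finset.card_insert_of_notMem hn1] at hc
      omega
    · obtain ⟨m, hmB, hm⟩ : ∃ m ∈ B, ∀ b ∈ B, m ≤ b :=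
        ⟨B.min' hBne, B.min'_mem _, fun a ha => B.min'_le a ha⟩
      have hsub : (A.erase m).image (fun x => x + m) ∪ (B.erase m).image (fun x => x + M)
          ⊆ restrictedSumset A B := by
        intro s hs
        rw [mem_rs]
        rcases Finset.mem_union.1 hs with hs | hs
        · obtain ⟨a, ha, rfl⟩ := Finset.mem_image.1 hs
          exact ⟨a, Finset.mem_of_mem_erase ha, m, hmB, Finset.ne_of_mem_erase ha, rfl⟩
        · obtain ⟨b, hb, rfl⟩ := Finset.mem_image.1 hs
          have hb' := Finset.mem_of_mem_erase hb
          exact ⟨M, hMA, b, hb', fun h => hMB (h ▸ hb'), add_comm _ _⟩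
      have hdis : Disjoint ((A.erase m).image (fun x => x + m))
          ((B.erase m).image (fun x => x + M)) := by
        rw [Finset.disjoint_left]
        intro s hs ht
        obtain ⟨a, ha, rfl⟩ := Finset.mem_image.1 hs
        obtain ⟨b, hb, h⟩ := Finset.mem_image.1 ht
        have hb' := Finset.mem_erase.1 hb
        have h1 := hM a (Finset.mem_of_mem_erase ha)
        have h2 := hm b hb'.2
        have h3 := hb'.1
        omega
      have hc := Finset.card_le_card hsub
      rw [Finset.card_union_of_disjoint hdis,
        Finset.card_image_of_injective _ (add_left_injective m),
        Finset.card_image_of_injective _ (add_left_injective M),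
        Finset.card_erase_of_mem hmB, Finset.card_erase_of_mem (hBA.1 hmB)] at hc
      omega

theorem stmt_8 (A B : Finset ℤ) (hA : 2 ≤ A.card) (hB : 2 ≤ B.card)
    (hBA : B ⊂ A) :
    A.card + B.card - 2 ≤ (restrictedSumset A B).card := by
  have := rs_aux (B.card - 1) A B (by omega) hBA
  omega
end
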